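/- Let d be a positive integer and let J ⊊ I be squarefree monomial ideals of S such that I is generated by squarefree monomials f_1,…,f_r of degree d together with a set E of squarefree monomials of degrees ≥ d+1, and J is either 0 or generated by squarefree monomials of degrees ≥ d+1. If s > q + r, then sdepth_S I/J ≤ d+1. -/

import Mathlib

open MvPolynomial

/-- The squarefree monomial `∏_{i ∈ T} x_i` in `K[x_1,…,x_n]`. -/
noncomputable def sqm (K : Type*) [Field K] {n : ℕ} (T : Finset (Fin n)) :
    MvPolynomial (Fin n) K := ∏ i ∈ T, X i

/-- The poset `P_{I \ J}` of (supports of) squarefree monomials of `I \ J`. -/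
def sqPoset {K : Type*} [Field K] {n : ℕ} (I J : Ideal (MvPolynomial (Fin n) K)) :
    Set (Finset (Fin n)) :=
  {T | sqm K T ∈ I ∧ sqm K T ∉ J}

/-- The squarefree monomials of degree `k` in `I \ J`. -/
def degSet {K : Type*} [Field K] {n : ℕ} (I J : Ideal (MvPolynomial (Fin n) K)) (k : ℕ) :
    Set (Finset (Fin n)) :=
  {T ∈ sqPoset I J | T.card = k}

/-- A partition of `P_{I\J}` into intervals `[u,v]`, recorded as a finite set of
pairs `(u, v)`: each monomial of `P_{I\J}` lies in exactly one interval. -/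
def IsIntervalPartition {K : Type*} [Field K] {n : ℕ}
    (I J : Ideal (MvPolynomial (Fin n) K))
    (F : Finset (Finset (Fin n) × Finset (Fin n))) : Prop :=
  (∀ p ∈ F, p.1 ∈ sqPoset I J ∧ p.2 ∈ sqPoset I J ∧ p.1 ⊆ p.2) ∧
  (∀ T ∈ sqPoset I J, ∃! p, p ∈ F ∧ p.1 ⊆ T ∧ T ⊆ p.2)

/-- The Stanley depth of `I/J`: the maximum over interval partitions of the
minimal degree of an upper endpoint. -/
noncomputable def sdepth {K : Type*} [Field K] {n : ℕ}
    (I J : Ideal (MvPolynomial (Fin n) K)) : ℕ :=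
  sSup {k | ∃ F, IsIntervalPartition I J F ∧ ∀ p ∈ F, k ≤ p.2.card}

/-- The depth of a module over `K[x_1,…,x_n]` with respect to the maximal ideal
`(x_1,…,x_n)`: the supremum of lengths of regular sequences from `(x_1,…,x_n)`. -/
noncomputable def mdepth {K : Type*} [Field K] {n : ℕ}
    (M : Type*) [AddCommGroup M] [Module (MvPolynomial (Fin n) K) M] : ℕ :=
  sSup {k | ∃ rs : List (MvPolynomial (Fin n) K), rs.length = k ∧
    (∀ r ∈ rs, r ∈ Ideal.span (Set.range X : Set (MvPolynomial (Fin n) K))) ∧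
    RingTheory.Sequence.IsRegular M rs}

/-- The `S`-module `I/J` (more precisely `I/(J ∩ I)`). -/
abbrev quotMod {K : Type*} [Field K] {n : ℕ} (I J : Ideal (MvPolynomial (Fin n) K)) :=
  I ⧸ (Submodule.comap I.subtype J)

/-- `depth_S I/J`. -/
noncomputable def depthIJ {K : Type*} [Field K] {n : ℕ}
    (I J : Ideal (MvPolynomial (Fin n) K)) : ℕ :=
  mdepth (K := K) (n := n) (quotMod I J)

/-- An ideal is a squarefree monomial ideal generated in degrees `≥ d` if it is
the span of squarefree monomials whose supports have at least `d` elements. -/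
def SqfreeGenFrom {K : Type*} [Field K] {n : ℕ}
    (L : Ideal (MvPolynomial (Fin n) K)) (d : ℕ) : Prop :=
  ∃ G : Set (Finset (Fin n)), (∀ T ∈ G, d ≤ T.card) ∧ L = Ideal.span (sqm K '' G)

/-- A squarefree monomial ideal. -/
def IsSqfreeMonomialIdeal {K : Type*} [Field K] {n : ℕ}
    (L : Ideal (MvPolynomial (Fin n) K)) : Prop :=
  ∃ G : Set (Finset (Fin n)), L = Ideal.span (sqm K '' G)

theorem sqm_eq_monomial (K : Type*) [Field K] {n : ℕ} (T : Finset (Fin n)) :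
    sqm K T = monomial (∑ i ∈ T, Finsupp.single i 1) 1 := by
  rw [sqm, monomial_sum_one]
  rfl

theorem sqm_dvd_sqm (K : Type*) [Field K] {n : ℕ} {S T : Finset (Fin n)} (h : S ⊆ T) :
    sqm K S ∣ sqm K T :=
  Finset.prod_dvd_prod_of_subset _ _ _ h

/-- A squarefree monomial in a squarefree monomial ideal is divisible by a generator. -/
theorem exists_subset_of_sqm_mem_span {K : Type*} [Field K] {n : ℕ} {G : Set (Finset (Fin n))}
    {T : Finset (Fin n)} (h : sqm K T ∈ Ideal.span (sqm K '' G)) : ∃ S ∈ G, S ⊆ T := by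
  have himage : sqm K '' G = (fun s : Fin n →₀ ℕ => monomial s (1 : K)) ''
      ((fun S : Finset (Fin n) => ∑ i ∈ S, Finsupp.single i 1) '' G) := by
    rw [Set.image_image]
    exact Set.image_congr fun S _ => sqm_eq_monomial K S
  rw [himage, mem_ideal_span_monomial_image, sqm_eq_monomial] at h
  obtain ⟨_, ⟨S, hS, rfl⟩, hle⟩ := h (∑ i ∈ T, Finsupp.single i 1) (by simp [mem_support_iff])
  refine ⟨S, hS, fun i hi => ?_⟩
  by_contra hiT
  have := hle i
  simp [Finsupp.finsetSum_apply, Finsupp.single_apply, hi, hiT] at this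

theorem mem_sqPoset_of_subset_of_subset {K : Type*} [Field K] {n : ℕ}
    {I J : Ideal (MvPolynomial (Fin n) K)} {u T v : Finset (Fin n)}
    (hu : u ∈ sqPoset I J) (hv : v ∈ sqPoset I J) (huT : u ⊆ T) (hTv : T ⊆ v) :
    T ∈ sqPoset I J :=
  ⟨I.mem_of_dvd (sqm_dvd_sqm K huT) hu.1, fun h => hv.2 (J.mem_of_dvd (sqm_dvd_sqm K hTv) h)⟩

/-- Given an interval partition whose upper endpoints have degree at least `k + 2`, toggling in
each interval `[u, v]` a fixed variable of `v / u` injects the monomials of degree `k + 1` into those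
of degrees `k` and `k + 2`. -/
theorem IsIntervalPartition.ncard_degSet_le {K : Type*} [Field K] {n : ℕ}
    {I J : Ideal (MvPolynomial (Fin n) K)} {F : Finset (Finset (Fin n) × Finset (Fin n))}
    (hF : IsIntervalPartition I J F) {k : ℕ} (hk : ∀ p ∈ F, k + 2 ≤ p.2.card) :
    (degSet I J (k + 1)).ncard ≤ (degSet I J (k + 2)).ncard + (degSet I J k).ncard := by
  have hinterval : ∀ b ∈ degSet I J (k + 1), ∃ p ∈ F, p.1 ⊆ b ∧ b ⊆ p.2 := fun b hb =>
    (hF.2 b hb.1).exists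
  choose! P hPF hPl hPu using hinterval
  have hvar : ∀ p : Finset (Fin n) × Finset (Fin n), ∃ m : Option (Fin n),
      ∀ b ∈ degSet I J (k + 1), p ∈ F → p.1 ⊆ b → ∃ x, m = some x ∧ x ∈ p.2 ∧ x ∉ p.1 := by
    intro p
    by_cases h : ∃ x, x ∈ p.2 ∧ x ∉ p.1
    · obtain ⟨x, hx⟩ := h
      exact ⟨some x, fun _ _ _ _ => ⟨x, rfl, hx⟩⟩
    · refine ⟨none, fun b hb hp hpb => absurd (Finset.exists_mem_notMem_of_card_lt_card ?_) h⟩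
      have := Finset.card_le_card hpb
      have := hk p hp
      have := hb.2
      omega
  choose m hm using hvar
  let g : Finset (Fin n) → Finset (Fin n) := fun b => symmDiff b (m (P b)).toFinset
  have hg : ∀ b ∈ degSet I J (k + 1), (P b).1 ⊆ g b ∧ g b ⊆ (P b).2 ∧
      ((g b).card = k + 2 ∨ (g b).card = k) := by
    intro b hb
    obtain ⟨x, hx, hxu, hxl⟩ := hm (P b) b hb (hPF b hb) (hPl b hb)
    have hl := hPl b hb
    have hu := hPu b hb
    have hc := hb.2
    by_cases hxb : x ∈ b
    · have hgb : g b = b.erase x := by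
        ext y
        simp only [g, hx, Option.toFinset_some, Finset.mem_symmDiff, Finset.mem_singleton,
          Finset.mem_erase]
        grind
      rw [hgb, Finset.card_erase_of_mem hxb]
      exact ⟨Finset.subset_erase.2 ⟨hl, hxl⟩, (Finset.erase_subset _ _).trans hu, by omega⟩
    · have hgb : g b = insert x b := by
        ext y
        simp only [g, hx, Option.toFinset_some, Finset.mem_symmDiff, Finset.mem_singleton,
          Finset.mem_insert]
        grind
      rw [hgb, Finset.card_insert_of_notMem hxb]
      exact ⟨hl.trans (Finset.subset_insert _ _), Finset.insert_subset hxu hu, by omega⟩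
  have hmem : ∀ b ∈ degSet I J (k + 1), g b ∈ sqPoset I J := fun b hb =>
    have hp := hF.1 _ (hPF b hb)
    mem_sqPoset_of_subset_of_subset hp.1 hp.2.1 (hg b hb).1 (hg b hb).2.1
  refine (Set.ncard_le_ncard_of_injOn g (t := degSet I J (k + 2) ∪ degSet I J k) ?_ ?_
    (Set.toFinite _)).trans (Set.ncard_union_le _ _)
  · exact fun b hb => (hg b hb).2.2.imp (⟨hmem b hb, ·⟩) (⟨hmem b hb, ·⟩)
  · intro b hb b' hb' hbb'
    have hP : P b = P b' := (hF.2 _ (hmem b hb)).unique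
      ⟨hPF b hb, (hg b hb).1, (hg b hb).2.1⟩
      ⟨hPF b' hb', hbb' ▸ (hg b' hb').1, hbb' ▸ (hg b' hb').2.1⟩
    simp only [g, hP] at hbb'
    exact symmDiff_left_injective _ hbb'

/-- if `s > q + r` then `sdepth I/J ≤ d + 1`. -/
theorem statement12 {K : Type*} [Field K] {n : ℕ} (d : ℕ) (hd : 0 < d) (r : ℕ)
    (I J : Ideal (MvPolynomial (Fin n) K)) (hJI : J < I)
    (f : Fin r → Finset (Fin n)) (hfd : ∀ i, (f i).card = d)
    (E : Set (Finset (Fin n))) (hE : ∀ T ∈ E, d + 1 ≤ T.card)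
    (hI : I = Ideal.span (sqm K '' (Set.range f ∪ E)))
    (hJ : SqfreeGenFrom J (d + 1))
    (hsq : (degSet I J (d + 2)).ncard + r < (degSet I J (d + 1)).ncard) :
    sdepth I J ≤ d + 1 := by
  have hgen : degSet I J d ⊆ Set.range f := by
    rintro T ⟨⟨hTI, -⟩, hTd⟩
    rw [hI] at hTI
    obtain ⟨S, hS, hST⟩ := exists_subset_of_sqm_mem_span hTI
    rcases hS with ⟨i, rfl⟩ | hSE
    · exact ⟨i, Finset.eq_of_subset_of_card_le hST (by rw [hTd, hfd])⟩
    · have := Finset.card_le_card hST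
      have := hE S hSE
      omega
  have hr : (degSet I J d).ncard ≤ r :=
    (Set.ncard_le_ncard hgen).trans <| by
      simpa [Set.image_univ] using Set.ncard_image_le (f := f) Set.finite_univ
  refine csSup_le' ?_
  rintro k ⟨F, hF, hk⟩
  by_contra! hlt
  have := hF.ncard_degSet_le fun p hp => (show d + 2 ≤ k by omega).trans (hk p hp)
  omega
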